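/- arXiv:1806.09706 — 2 statements merged into one kernel-verified Lean document; each statement's English description precedes it below -/
import Mathlib

section
/- Let f : ℝ² → ℂ be integrable with polar-separable Fourier transform: 𝓕₂f(ξ) = γ(θ_ξ)·ĥ(|ξ|)·e^{−2πi⟨ξ,k⟩} for all ξ ≠ 0, where γ : ℝ → ℂ is bounded measurable, ĥ : [0,∞) → ℂ, and k ∈ ℝ². Then the one-dimensional Fourier transform of the marginal f₂(x₁) = ∫_ℝ f(x₁, x₂) dx₂ satisfies 𝓕₁f₂(ξ₁) = γ(0)·ĥ(ξ₁)·e^{−2πi ξ₁ k₁} for every ξ₁ > 0 and 𝓕₁f₂(ξ₁) = γ(π)·ĥ(−ξ₁)·e^{−2πi ξ₁ k₁} for every ξ₁ < 0. In particular, the projected function has again a polar-separable (one-dimensional) Fourier transform with the same radial window ĥ, depends on k only through the projected location k₁, and depends on the angular window γ only through the scalar values γ(0), γ(π). (Frequency-domain content of Proposition 1.) -/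
open MeasureTheory Real
open scoped FourierTransform RealInnerProductSpace

/-- The point `(x, y)` of the Euclidean plane. -/
noncomputable def v2 (x y : ℝ) : EuclideanSpace ℝ (Fin 2) :=
  (WithLp.equiv 2 (Fin 2 → ℝ)).symm ![x, y]

theorem v2_measurePreserving :
    MeasurePreserving (fun p : ℝ × ℝ => v2 p.1 p.2) := by
  have h := (PiLp.volume_preserving_toLp (Fin 2)).comp
    (volume_preserving_finTwoArrow ℝ).symm
  exact h

theorem v2_measurableEmbedding :
    MeasurableEmbedding (fun p : ℝ × ℝ => v2 p.1 p.2) :=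
  ((MeasurableEquiv.finTwoArrow (α := ℝ)).symm.trans
    (MeasurableEquiv.toLp 2 (Fin 2 → ℝ))).measurableEmbedding

/-- **Fourier slice theorem**: the Fourier transform of the marginal of an integrable function
on the plane is the restriction of its Fourier transform to the first axis. -/
theorem fourier_marginal_eq_fourier_slice {f : EuclideanSpace ℝ (Fin 2) → ℂ}
    (hf : Integrable f) (ξ : ℝ) :
    𝓕 (fun x : ℝ => ∫ y : ℝ, f (v2 x y)) ξ = 𝓕 f (v2 ξ 0) := by
  have hint : Integrable fun v => 𝐞 (-⟪v, v2 ξ 0⟫) • f v :=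
    (Real.fourierIntegral_convergent_iff (v2 ξ 0)).2 hf
  have hint' : Integrable fun p : ℝ × ℝ => 𝐞 (-⟪v2 p.1 p.2, v2 ξ 0⟫) • f (v2 p.1 p.2) :=
    v2_measurePreserving.integrable_comp_of_integrable hint
  have hinner (x y : ℝ) : ⟪v2 x y, v2 ξ 0⟫ = x * ξ := by
    simp [v2, PiLp.inner_apply, mul_comm]
  rw [Real.fourier_eq f, ← v2_measurePreserving.integral_comp v2_measurableEmbedding,
    Measure.volume_eq_prod, integral_prod _ hint', Real.fourier_real_eq]
  simp_rw [hinner, Circle.smul_def, integral_smul]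

/-- **Frequency-domain content of Proposition 1.**
Let `f : ℝ² → ℂ` be integrable with polar-separable Fourier transform
`𝓕 f ξ = γ θ_ξ * hRad |ξ| * e^{-2πi⟨ξ,k⟩}` for `ξ ≠ 0` (every nonzero `ξ` being written
as `ξ = (r cos θ, r sin θ)` with `r > 0`, `θ ∈ [0, 2π)`), where `γ` is bounded measurable.
Then the Fourier transform of the marginal `f₂ x₁ = ∫ x₂, f (x₁, x₂)` is
`γ 0 * hRad ξ₁ * e^{-2πi ξ₁ k₁}` for `ξ₁ > 0` and `γ π * hRad (-ξ₁) * e^{-2πi ξ₁ k₁}`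
for `ξ₁ < 0`. -/
theorem fourier_slice_polar_separable_frequency (f : EuclideanSpace ℝ (Fin 2) → ℂ)
    (hf : Integrable f) (γ : ℝ → ℂ) (hγ_meas : Measurable γ)
    (C : ℝ) (hγ_bdd : ∀ θ : ℝ, ‖γ θ‖ ≤ C)
    (hRad : ℝ → ℂ) (k : EuclideanSpace ℝ (Fin 2))
    (hsep : ∀ r θ : ℝ, 0 < r → θ ∈ Set.Ico 0 (2 * π) →
      𝓕 f (v2 (r * Real.cos θ) (r * Real.sin θ)) =
        γ θ * hRad r *
          Complex.exp (-(2 * (π : ℂ) * Complex.I) *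
            ((r * Real.cos θ * k 0 + r * Real.sin θ * k 1 : ℝ) : ℂ))) :
    (∀ ξ₁ : ℝ, 0 < ξ₁ →
      𝓕 (fun x₁ : ℝ => ∫ x₂ : ℝ, f (v2 x₁ x₂)) ξ₁ =
        γ 0 * hRad ξ₁ * Complex.exp (-(2 * (π : ℂ) * Complex.I) * ((ξ₁ * k 0 : ℝ) : ℂ))) ∧
    (∀ ξ₁ : ℝ, ξ₁ < 0 →
      𝓕 (fun x₁ : ℝ => ∫ x₂ : ℝ, f (v2 x₁ x₂)) ξ₁ =
        γ π * hRad (-ξ₁) * Complex.exp (-(2 * (π : ℂ) * Complex.I) * ((ξ₁ * k 0 : ℝ) : ℂ))) := by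
  refine ⟨fun ξ hξ => ?_, fun ξ hξ => ?_⟩
  · rw [fourier_marginal_eq_fourier_slice hf]
    simpa using hsep ξ 0 hξ ⟨le_rfl, by positivity⟩
  · rw [fourier_marginal_eq_fourier_slice hf]
    simpa using hsep (-ξ) π (neg_pos.2 hξ) ⟨pi_pos.le, by linarith [pi_pos]⟩
end

section
/- Let f : ℝ² → ℂ be integrable with polar-separable Fourier transform 𝓕₂f(ξ) = γ(θ_ξ)·ĥ(|ξ|)·e^{−2πi⟨ξ,k⟩} for ξ ≠ 0, where γ : ℝ → ℂ is bounded measurable, k ∈ ℝ², and ĥ : [0,∞) → ℂ is continuous with compact support. Then the marginal f₂(x₁) = ∫_ℝ f(x₁, x₂) dx₂ satisfies, for almost every x₁, f₂(x₁) = w(x₁ − k₁), where w : ℝ → ℂ is the function w(x) = ∫_0^∞ γ(0)·ĥ(ξ)·e^{2πiξx} dξ + ∫_0^∞ γ(π)·ĥ(ξ)·e^{−2πiξx} dξ, which is independent of k₂. In other words, slicing a polar-separable two-dimensional wavelet yields a fixed one-dimensional profile translated to the projected position k₁ (spatial-domain content of Proposition 1). -/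
open MeasureTheory Real
open scoped FourierTransform RealInnerProductSpace

/-- **Fourier inversion formula**, almost everywhere version: an integrable function whose Fourier
transform is integrable agrees almost everywhere with the inverse Fourier transform of its
Fourier transform. -/
theorem MeasureTheory.Integrable.fourierInv_fourier_ae_eq {V E : Type*} [NormedAddCommGroup V]
    [InnerProductSpace ℝ V] [MeasurableSpace V] [BorelSpace V] [FiniteDimensional ℝ V]
    [NormedAddCommGroup E] [NormedSpace ℂ E] [CompleteSpace E] {f : V → E}
    (hf : Integrable f) (hf' : Integrable (𝓕 f)) : 𝓕⁻ (𝓕 f) =ᵐ[volume] f := by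
  have hL : Continuous fun p : V × V ↦ (innerₗ V) p.1 p.2 := continuous_inner
  have hL' : Continuous fun p : V × V ↦ (-innerₗ V) p.1 p.2 := continuous_inner.neg
  have hcont : Continuous (𝓕⁻ (𝓕 f)) :=
    VectorFourier.fourierIntegral_continuous continuous_fourierChar hL' hf'
  refine ae_eq_of_integral_contDiff_smul_eq hcont.locallyIntegrable hf.locallyIntegrable ?_
  intro g hg hgc
  have hc : HasCompactSupport (Complex.ofRealCLM ∘ g) := hgc.comp_left rfl
  let G : SchwartzMap V ℂ := hc.toSchwartzMap (by fun_prop)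
  have hG (x : V) (e : E) : g x • e = G x • e := (Complex.coe_smul (g x) e).symm
  have hflip : (-innerₗ V).flip = -innerₗ V := by
    ext x y
    simp [real_inner_comm]
  have h₁ : ∫ x, (𝓕⁻ (G : V → ℂ)) x • 𝓕 f x = ∫ x, G x • 𝓕⁻ (𝓕 f) x := by
    have := VectorFourier.integral_fourierIntegral_smul_eq_flip (μ := volume) (ν := volume)
      continuous_fourierChar hL' G.integrable hf'
    rwa [hflip] at this
  have h₂ : ∫ x, 𝓕 (𝓕⁻ (G : V → ℂ)) x • f x = ∫ x, (𝓕⁻ (G : V → ℂ)) x • 𝓕 f x := by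
    have hu : Integrable (𝓕⁻ (G : V → ℂ)) := by
      rw [← SchwartzMap.fourierInv_coe]
      exact (𝓕⁻ G).integrable
    have := VectorFourier.integral_fourierIntegral_smul_eq_flip (μ := volume) (ν := volume)
      continuous_fourierChar hL hu hf
    rwa [flip_innerₗ] at this
  have h₃ : 𝓕 (𝓕⁻ (G : V → ℂ)) = G := by
    rw [← SchwartzMap.fourierInv_coe, ← SchwartzMap.fourier_coe,
      FourierTransform.fourier_fourierInv_eq]
  simp_rw [hG]
  rw [← h₁, ← h₂, h₃]

theorem measurePreserving_v2 :
    MeasurePreserving (fun p : ℝ × ℝ ↦ v2 p.1 p.2) :=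
  (PiLp.volume_preserving_toLp (Fin 2)).comp (volume_preserving_finTwoArrow ℝ).symm

theorem measurableEmbedding_v2 : MeasurableEmbedding (fun p : ℝ × ℝ ↦ v2 p.1 p.2) :=
  (MeasurableEquiv.toLp 2 (Fin 2 → ℝ)).measurableEmbedding.comp
    MeasurableEquiv.finTwoArrow.symm.measurableEmbedding

theorem integrable_comp_v2 {E : Type*} [NormedAddCommGroup E] {f : EuclideanSpace ℝ (Fin 2) → E}
    (hf : Integrable f) : Integrable (fun p : ℝ × ℝ ↦ f (v2 p.1 p.2)) :=
  (measurePreserving_v2.integrable_comp_emb measurableEmbedding_v2).2 hf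

/-- **Fourier slice theorem** in the plane: the Fourier transform of the marginal of an integrable
function is the restriction of its Fourier transform to the first coordinate axis. -/
theorem fourier_marginal {E : Type*} [NormedAddCommGroup E] [NormedSpace ℂ E]
    {f : EuclideanSpace ℝ (Fin 2) → E} (hf : Integrable f) (ξ : ℝ) :
    𝓕 (fun x : ℝ ↦ ∫ y : ℝ, f (v2 x y)) ξ = 𝓕 f (v2 ξ 0) := by
  have hint : Integrable fun v ↦ 𝐞 (-⟪v, v2 ξ 0⟫) • f v :=
    (fourierIntegral_convergent_iff _).2 hf
  rw [fourier_eq, fourier_eq, ← measurePreserving_v2.integral_comp measurableEmbedding_v2,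
    Measure.volume_eq_prod, integral_prod _ (integrable_comp_v2 hint)]
  refine integral_congr_ae (.of_forall fun x ↦ ?_)
  simp only [Circle.smul_def]
  rw [← integral_smul]
  simp [v2, PiLp.inner_apply, mul_comm]

/-- **Spatial-domain content of Proposition 1.**
Let `f : ℝ² → ℂ` be integrable with polar-separable Fourier transform
`𝓕 f ξ = γ θ_ξ * hRad |ξ| * e^{-2πi⟨ξ,k⟩}` for `ξ ≠ 0`, where `γ` is bounded measurable
and the radial window `hRad` is continuous with compact support.  Then for a.e. `x₁` the
marginal `f₂ x₁ = ∫ x₂, f (x₁, x₂)` equals `w (x₁ - k₁)` where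
`w x = ∫_0^∞ γ 0 * hRad ξ * e^{2πiξx} dξ + ∫_0^∞ γ π * hRad ξ * e^{-2πiξx} dξ`,
a fixed one-dimensional profile (independent of `k₂`) translated to the projected
position `k₁`. -/
theorem fourier_slice_polar_separable_spatial (f : EuclideanSpace ℝ (Fin 2) → ℂ)
    (hf : Integrable f) (γ : ℝ → ℂ) (hγ_meas : Measurable γ)
    (C : ℝ) (hγ_bdd : ∀ θ : ℝ, ‖γ θ‖ ≤ C)
    (hRad : ℝ → ℂ) (hRad_cont : Continuous hRad) (hRad_supp : HasCompactSupport hRad)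
    (k : EuclideanSpace ℝ (Fin 2))
    (hsep : ∀ r θ : ℝ, 0 < r → θ ∈ Set.Ico 0 (2 * π) →
      𝓕 f (v2 (r * Real.cos θ) (r * Real.sin θ)) =
        γ θ * hRad r *
          Complex.exp (-(2 * (π : ℂ) * Complex.I) *
            ((r * Real.cos θ * k 0 + r * Real.sin θ * k 1 : ℝ) : ℂ))) :
    ∀ᵐ x₁ : ℝ, (∫ x₂ : ℝ, f (v2 x₁ x₂)) =
      (∫ ξ in Set.Ioi (0 : ℝ),
        γ 0 * hRad ξ * Complex.exp (2 * (π : ℂ) * Complex.I * ((ξ * (x₁ - k 0) : ℝ) : ℂ))) +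
      (∫ ξ in Set.Ioi (0 : ℝ),
        γ π * hRad ξ * Complex.exp (-(2 * (π : ℂ) * Complex.I) * ((ξ * (x₁ - k 0) : ℝ) : ℂ))) := by
  set g : ℝ → ℂ := fun x ↦ ∫ y : ℝ, f (v2 x y) with hg_def
  have hg : Integrable g := (integrable_comp_v2 hf).integral_prod_left
  have hpos (ξ : ℝ) (hξ : 0 < ξ) : 𝓕 g ξ = γ 0 * hRad ξ *
      Complex.exp (-(2 * (π : ℂ) * Complex.I) * ((ξ * k 0 : ℝ) : ℂ)) := by
    rw [hg_def, fourier_marginal hf]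
    simpa using hsep ξ 0 hξ ⟨le_rfl, by positivity⟩
  have hneg (ξ : ℝ) (hξ : 0 < ξ) : 𝓕 g (-ξ) = γ π * hRad ξ *
      Complex.exp (2 * (π : ℂ) * Complex.I * ((ξ * k 0 : ℝ) : ℂ)) := by
    rw [hg_def, fourier_marginal hf]
    simpa using hsep ξ π hξ ⟨pi_pos.le, by linarith [pi_pos]⟩
  have hint_pos : IntegrableOn (𝓕 g) (Set.Ioi 0) := by
    refine IntegrableOn.congr_fun (Integrable.integrableOn ?_) (fun ξ hξ ↦ (hpos ξ hξ).symm)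
      measurableSet_Ioi
    exact Continuous.integrable_of_hasCompactSupport (by fun_prop)
      (hRad_supp.mul_left.mul_right)
  have hint_neg : IntegrableOn (𝓕 g) (Set.Iic 0) := by
    rw [integrableOn_Iic_iff_integrableOn_Iio]
    suffices h : IntegrableOn (fun ξ ↦ 𝓕 g (-ξ)) (Set.Ioi (-0)) by simpa using h.comp_neg_Iio
    rw [neg_zero]
    refine IntegrableOn.congr_fun (Integrable.integrableOn ?_) (fun ξ hξ ↦ (hneg ξ hξ).symm)
      measurableSet_Ioi
    exact Continuous.integrable_of_hasCompactSupport (by fun_prop)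
      (hRad_supp.mul_left.mul_right)
  have hint : Integrable (𝓕 g) := by
    rw [← integrableOn_univ, ← Set.Iic_union_Ioi (a := (0 : ℝ))]
    exact hint_neg.union hint_pos
  filter_upwards [hg.fourierInv_fourier_ae_eq hint] with x hx
  have hchar : Integrable fun ξ : ℝ ↦ 𝐞 ⟪ξ, x⟫ • 𝓕 g ξ := by
    simpa using (fourierIntegral_convergent_iff (-x)).2 hint
  change g x = _
  rw [← hx, fourierInv_eq,
    ← intervalIntegral.integral_Iic_add_Ioi hchar.integrableOn hchar.integrableOn, add_comm]
  congr 1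
  · refine setIntegral_congr_fun measurableSet_Ioi fun ξ hξ ↦ ?_
    simp only [hpos ξ hξ, Circle.smul_def, fourierChar_apply, smul_eq_mul]
    rw [mul_left_comm, ← Complex.exp_add]
    congr 2
    simp
    ring
  · rw [← neg_zero, ← integral_comp_neg_Ioi, neg_zero]
    refine setIntegral_congr_fun measurableSet_Ioi fun ξ hξ ↦ ?_
    simp only [hneg ξ hξ, Circle.smul_def, fourierChar_apply, smul_eq_mul]
    rw [mul_left_comm, ← Complex.exp_add]
    congr 2
    simp
    ring
end
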